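/- arXiv:2505.08079 — 3 statements merged into one kernel-verified Lean document; each statement's English description precedes it below -/
import Mathlib

section
/- Suppose each of A, B, C is coprime to MN. Then the MN×MN complex matrix U with entries U[n,m] = (1/√(MN))·e^{(2πi/(MN))(A n² + B n m + C m²)} for n, m ∈ {0, …, MN−1} is unitary, i.e., Uᴴ U equals the MN×MN identity matrix. -/
/-- Orthogonality of the integer powers of a primitive `K`-th root of unity. -/
theorem IsPrimitiveRoot.sum_zpow_mul_eq_ite {F : Type*} [Field F] {ζ : F} {K : ℕ}
    (hζ : IsPrimitiveRoot ζ K) (z : ℤ) :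
    ∑ n : Fin K, ζ ^ (z * ((n : ℕ) : ℤ)) = if (K : ℤ) ∣ z then (K : F) else 0 := by
  simp_rw [zpow_mul, zpow_natCast]
  split_ifs with h
  · simp [(hζ.zpow_eq_one_iff_dvd z).2 h]
  · have hne : ζ ^ z - 1 ≠ 0 := sub_ne_zero.2 fun h1 => h ((hζ.zpow_eq_one_iff_dvd z).1 h1)
    have hpow : (ζ ^ z) ^ K = 1 := by
      rw [← zpow_natCast, ← zpow_mul, mul_comm, zpow_mul, zpow_natCast, hζ.pow_eq_one, one_zpow]
    rw [Fin.sum_univ_eq_sum_range fun i => (ζ ^ z) ^ i]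
    refine (mul_eq_zero.1 ?_).resolve_right hne
    rw [geom_sum_mul, hpow, sub_self]

theorem Fin.eq_of_intCast_dvd_sub {K : ℕ} {i j : Fin K}
    (h : (K : ℤ) ∣ ((j : ℕ) : ℤ) - ((i : ℕ) : ℤ)) : i = j :=
  Fin.ext <| Nat.ModEq.eq_of_lt_of_lt (Nat.modEq_iff_dvd.2 h) i.isLt j.isLt


/-- **Unitarity of the GDAFT matrix.**
If `A`, `B`, `C` are each coprime to `M*N`, the `MN × MN` matrix with entries
`U[n,m] = (1/√(MN)) · e^{(2πi/(MN))(A n² + B n m + C m²)}` is unitary: `Uᴴ U = I`. -/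
theorem gdaft_matrix_unitary (M N : ℕ) (hM : 0 < M) (hN : 0 < N) (A B C : ℤ)
    (hA : IsCoprime A ((M * N : ℕ) : ℤ)) (hB : IsCoprime B ((M * N : ℕ) : ℤ))
    (hC : IsCoprime C ((M * N : ℕ) : ℤ))
    (U : Matrix (Fin (M * N)) (Fin (M * N)) ℂ)
    (hU : ∀ n m : Fin (M * N),
      U n m = (Real.sqrt (M * N) : ℂ)⁻¹ *
        Complex.exp (2 * Real.pi * Complex.I *
          ((A * (n : ℕ) ^ 2 + B * (n : ℕ) * (m : ℕ) + C * (m : ℕ) ^ 2 : ℤ) : ℂ) /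
            ((M * N : ℕ) : ℂ))) :
    U.conjTranspose * U = 1 := by
  have hK : M * N ≠ 0 := (Nat.mul_pos hM hN).ne'
  have hKC : ((M * N : ℕ) : ℂ) ≠ 0 := Nat.cast_ne_zero.2 hK
  have hζ := Complex.isPrimitiveRoot_exp (M * N) hK
  set ζ : ℂ := Complex.exp (2 * Real.pi * Complex.I / ((M * N : ℕ) : ℂ))
  have hζ0 : ζ ≠ 0 := Complex.exp_ne_zero _
  have hstar : star ζ = ζ⁻¹ :=
    (Complex.inv_eq_conj (Complex.norm_eq_one_of_pow_eq_one hζ.pow_eq_one hK)).symm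
  have hexp (z : ℤ) :
      Complex.exp (2 * Real.pi * Complex.I * (z : ℂ) / ((M * N : ℕ) : ℂ)) = ζ ^ z := by
    rw [← Complex.exp_int_mul]
    congr 1
    ring
  have hsqrt : star ((Real.sqrt (M * N) : ℂ)⁻¹) * (Real.sqrt (M * N) : ℂ)⁻¹ =
      ((M * N : ℕ) : ℂ)⁻¹ := by
    rw [star_inv₀, Complex.star_def, Complex.conj_ofReal, ← mul_inv, ← Complex.ofReal_mul,
      Real.mul_self_sqrt (by positivity)]
    push_cast
    rfl
  ext j k
  have hterm (n : Fin (M * N)) : star (U n j) * U n k =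
      ((M * N : ℕ) : ℂ)⁻¹ * ζ ^ (C * ((k : ℕ) ^ 2 - (j : ℕ) ^ 2) : ℤ) *
        ζ ^ (B * ((k : ℕ) - (j : ℕ)) * (n : ℕ) : ℤ) := by
    rw [hU, hU, hexp, hexp, star_mul', star_zpow₀, hstar, inv_zpow', mul_mul_mul_comm, hsqrt,
      ← zpow_add₀ hζ0, mul_assoc (_)⁻¹, ← zpow_add₀ hζ0]
    congr 2
    ring
  simp_rw [Matrix.mul_apply, Matrix.conjTranspose_apply, hterm]
  rw [← Finset.mul_sum, hζ.sum_zpow_mul_eq_ite]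
  rcases eq_or_ne j k with rfl | hjk
  · simpa using inv_mul_cancel₀ hKC
  · rw [Matrix.one_apply_ne hjk, if_neg, mul_zero]
    exact fun h => hjk (Fin.eq_of_intCast_dvd_sub (hB.symm.dvd_of_dvd_mul_left h))
end

section
/- Suppose each of A, B, C is coprime to MN. Define the inverse GDAFT of a sequence x : ℤ/(MN)ℤ → ℂ by (F_a⁻¹ x)[m] = (1/√(MN)) · Σ_{n=0}^{MN−1} e^{−(2πi/(MN))(A n² + B n m + C m²)} x[n]. Then for every x : ℤ/(MN)ℤ → ℂ, F_a⁻¹(F_a x) = x and F_a(F_a⁻¹ x) = x. -/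
open Finset

/-- e^{2πi t / Q} for an integer `t` and modulus `Q`. -/
noncomputable def eFrac (Q : ℕ) (t : ℤ) : ℂ :=
  Complex.exp (2 * Real.pi * Complex.I * (t : ℂ) / (Q : ℂ))

/-- Generalized discrete affine Fourier transform (GDAFT). -/
noncomputable def gdaft (M N : ℕ) (A B C : ℤ) (x : ZMod (M * N) → ℂ) :
    ZMod (M * N) → ℂ :=
  fun n => (Real.sqrt (M * N) : ℂ)⁻¹ *
    ∑ m ∈ Finset.range (M * N),
      eFrac (M * N) (A * (n.val : ℤ) ^ 2 + B * (n.val : ℤ) * (m : ℤ) + C * (m : ℤ) ^ 2) *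
        x (m : ZMod (M * N))

/-- Inverse GDAFT. -/
noncomputable def igdaft (M N : ℕ) (A B C : ℤ) (x : ZMod (M * N) → ℂ) :
    ZMod (M * N) → ℂ :=
  fun m => (Real.sqrt (M * N) : ℂ)⁻¹ *
    ∑ n ∈ Finset.range (M * N),
      eFrac (M * N) (-(A * (n : ℤ) ^ 2 + B * (n : ℤ) * (m.val : ℤ) + C * (m.val : ℤ) ^ 2)) *
        x (n : ZMod (M * N))

/-- The pulsone localized at `(k0, l0)`. -/
noncomputable def pulsone (M N : ℕ) (k0 l0 : ℕ) : ZMod (M * N) → ℂ :=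
  fun n => if n.val % M = k0 then
    (Real.sqrt N : ℂ)⁻¹ * eFrac N ((n.val / M : ℕ) * l0) else 0

/-- Cross-ambiguity function of two `MN`-periodic sequences. -/
noncomputable def amb (M N : ℕ) (y x : ZMod (M * N) → ℂ) (k l : ZMod (M * N)) : ℂ :=
  ((M * N : ℕ) : ℂ)⁻¹ * ∑ n ∈ Finset.range (M * N),
    y (n : ZMod (M * N)) * (starRingEnd ℂ) (x ((n : ZMod (M * N)) - k)) *
      eFrac (M * N) (-((l * ((n : ZMod (M * N)) - k)).val : ℤ))

/-- Delay-Doppler shift operator. -/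
noncomputable def ddShift (M N : ℕ) (k l : ZMod (M * N)) (x : ZMod (M * N) → ℂ) :
    ZMod (M * N) → ℂ :=
  fun n => x (n - k) * eFrac (M * N) ((l * (n - k)).val : ℤ)

/-- Inner product ⟨x, y⟩ = Σ x[n] conj(y[n]). -/
noncomputable def innerMN (M N : ℕ) (x y : ZMod (M * N) → ℂ) : ℂ :=
  ∑ n ∈ Finset.range (M * N),
    x (n : ZMod (M * N)) * (starRingEnd ℂ) (y (n : ZMod (M * N)))

open ZMod in
theorem eFrac_eq_stdAddChar (Q : ℕ) [NeZero Q] (t : ℤ) :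
    eFrac Q t = stdAddChar (t : ZMod Q) := by
  rw [stdAddChar_coe, eFrac]

theorem sum_range_natCast_zmod {E : Type*} [AddCommMonoid E] (Q : ℕ) [NeZero Q]
    (F : ZMod Q → E) : ∑ m ∈ Finset.range Q, F (m : ZMod Q) = ∑ m : ZMod Q, F m := by
  refine Finset.sum_bij' (fun m _ => (m : ZMod Q)) (fun m _ => m.val) ?_ ?_ ?_ ?_ ?_
  · simp
  · intro m _
    simpa using m.val_lt
  · intro m hm
    exact ZMod.val_cast_of_lt (Finset.mem_range.mp hm)
  · simp
  · simp

/-- The chirp kernels `ψ (f n + b n k + g k)` and `ψ (-(f n + b n m + g m))` are inverse to each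
other up to the cardinality of the ring. -/
theorem AddChar.IsPrimitive.sum_chirp_mul_sum_chirp {R : Type*} [CommRing R] [Fintype R]
    {R' : Type*} [CommRing R'] [IsDomain R'] {ψ : AddChar R R'} (hψ : ψ.IsPrimitive)
    (f g : R → R) {b : R} (hb : IsUnit b) (x : R → R') (m : R) :
    ∑ n, ψ (-(f n + b * n * m + g m)) * ∑ k, ψ (f n + b * n * k + g k) * x k =
      Fintype.card R * x m := by
  classical
  have key (n k : R) : ψ (-(f n + b * n * m + g m)) * (ψ (f n + b * n * k + g k) * x k) =
      ψ (n * (b * (k - m))) * (ψ (g k - g m) * x k) := by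
    rw [← mul_assoc, ← mul_assoc, ← AddChar.map_add_eq_mul, ← AddChar.map_add_eq_mul]
    ring_nf
  simp_rw [Finset.mul_sum, key]
  rw [Finset.sum_comm]
  simp_rw [← Finset.sum_mul, AddChar.sum_mulShift _ hψ, hb.mul_right_eq_zero, sub_eq_zero]
  simp

theorem gdaft_apply (M N : ℕ) [NeZero (M * N)] (A B C : ℤ) (x : ZMod (M * N) → ℂ)
    (n : ZMod (M * N)) :
    gdaft M N A B C x n = (Real.sqrt (M * N) : ℂ)⁻¹ *
      ∑ m, ZMod.stdAddChar (A * n ^ 2 + B * n * m + C * m ^ 2 : ZMod (M * N)) * x m := by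
  rw [gdaft, ← sum_range_natCast_zmod]
  simp [eFrac_eq_stdAddChar]

theorem igdaft_apply (M N : ℕ) [NeZero (M * N)] (A B C : ℤ) (x : ZMod (M * N) → ℂ)
    (m : ZMod (M * N)) :
    igdaft M N A B C x m = (Real.sqrt (M * N) : ℂ)⁻¹ *
      ∑ n, ZMod.stdAddChar (-(A * n ^ 2 + B * n * m + C * m ^ 2) : ZMod (M * N)) * x n := by
  rw [igdaft, ← sum_range_natCast_zmod]
  simp [eFrac_eq_stdAddChar]

/-- **Inverse GDAFT.** If `A`, `B`, `C` are each coprime to `M*N`, then the inverse GDAFT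
inverts the GDAFT and vice versa. -/
theorem igdaft_gdaft_eq_self (M N : ℕ) (hM : 0 < M) (hN : 0 < N) (A B C : ℤ)
    (hA : IsCoprime A ((M * N : ℕ) : ℤ)) (hB : IsCoprime B ((M * N : ℕ) : ℤ))
    (hC : IsCoprime C ((M * N : ℕ) : ℤ)) :
    ∀ x : ZMod (M * N) → ℂ,
      igdaft M N A B C (gdaft M N A B C x) = x ∧
      gdaft M N A B C (igdaft M N A B C x) = x := by
  intro x
  have : NeZero (M * N) := ⟨(Nat.mul_pos hM hN).ne'⟩
  have hu : IsUnit (B : ZMod (M * N)) := by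
    obtain ⟨u, v, h⟩ := hB
    refine .of_mul_eq_one_right (u : ZMod (M * N)) ?_
    simpa only [Int.cast_add, Int.cast_mul, Int.cast_natCast, ZMod.natCast_self, mul_zero,
      add_zero, Int.cast_one] using congrArg (Int.cast : ℤ → ZMod (M * N)) h
  have hψ := ZMod.isPrimitive_stdAddChar (M * N)
  have hQ : (M * N : ℂ) ≠ 0 := by exact_mod_cast NeZero.ne (M * N)
  have hs : (Real.sqrt (M * N) : ℂ)⁻¹ * (Real.sqrt (M * N) : ℂ)⁻¹ * (M * N : ℂ) = 1 := by
    rw [← mul_inv, ← Complex.ofReal_mul, Real.mul_self_sqrt (by positivity)]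
    push_cast
    exact inv_mul_cancel₀ hQ
  constructor
  · funext m
    have h := hψ.sum_chirp_mul_sum_chirp (fun n => (A : ZMod (M * N)) * n ^ 2)
      (fun k => C * k ^ 2) hu x m
    rw [ZMod.card, Nat.cast_mul] at h
    simp_rw [igdaft_apply, gdaft_apply, mul_left_comm _ (Real.sqrt (M * N) : ℂ)⁻¹]
    rw [← Finset.mul_sum, h, ← mul_assoc, ← mul_assoc, hs, one_mul]
  · funext n
    have h := hψ.sum_chirp_mul_sum_chirp (fun m => -((C : ZMod (M * N)) * m ^ 2))
      (fun k => -(A * k ^ 2)) hu.neg x n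
    have e₁ (m : ZMod (M * N)) : -(-(C * m ^ 2) + -B * m * n + -(A * n ^ 2)) =
        A * n ^ 2 + B * n * m + C * m ^ 2 := by ring
    have e₂ (m k : ZMod (M * N)) : -(C * m ^ 2) + -B * m * k + -(A * k ^ 2) =
        -(A * k ^ 2 + B * k * m + C * m ^ 2) := by ring
    simp_rw [e₁, e₂] at h
    rw [ZMod.card, Nat.cast_mul] at h
    simp_rw [gdaft_apply, igdaft_apply, mul_left_comm _ (Real.sqrt (M * N) : ℂ)⁻¹]
    rw [← Finset.mul_sum, h, ← mul_assoc, ← mul_assoc, hs, one_mul]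
end

section
/- Suppose each of A, B, C is coprime to MN. Then the family of GDAFTs of the pulsones, {F_a x^{(p)}_{(k0,l0)} : 0 ≤ k0 ≤ M−1, 0 ≤ l0 ≤ N−1}, is an orthonormal family of MN elements of ℂ^{ℤ/(MN)ℤ}, hence an orthonormal basis of the space of functions ℤ/(MN)ℤ → ℂ. -/
open Finset

lemma eFrac_add (Q : ℕ) (s t : ℤ) : eFrac Q (s + t) = eFrac Q s * eFrac Q t := by
  rw [eFrac, eFrac, eFrac, ← Complex.exp_add]
  congr 1
  push_cast
  ring

@[simp]
lemma eFrac_zero (Q : ℕ) : eFrac Q 0 = 1 := by simp [eFrac]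

lemma conj_eFrac (Q : ℕ) (t : ℤ) : (starRingEnd ℂ) (eFrac Q t) = eFrac Q (-t) := by
  simp [eFrac, ← Complex.exp_conj, Complex.conj_ofNat]

lemma eFrac_nat_mul (Q n : ℕ) (t : ℤ) : eFrac Q (n * t) = eFrac Q t ^ n := by
  rw [eFrac, eFrac, ← Complex.exp_nat_mul]
  congr 1
  push_cast
  ring

lemma eFrac_eq_one_iff {Q : ℕ} (hQ : 0 < Q) (t : ℤ) : eFrac Q t = 1 ↔ (Q : ℤ) ∣ t := by
  have hQ' : (Q : ℂ) ≠ 0 := by exact_mod_cast hQ.ne'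
  rw [eFrac, Complex.exp_eq_one_iff]
  refine exists_congr fun n => ?_
  rw [div_eq_iff hQ', show (n : ℂ) * (2 * Real.pi * Complex.I) * Q
    = 2 * Real.pi * Complex.I * (Q * n) by ring, mul_right_inj' Complex.two_pi_I_ne_zero]
  norm_cast

lemma sum_eFrac {Q : ℕ} (hQ : 0 < Q) (t : ℤ) :
    ∑ n ∈ Finset.range Q, eFrac Q (n * t) = if (Q : ℤ) ∣ t then (Q : ℂ) else 0 := by
  simp_rw [eFrac_nat_mul]
  split_ifs with h
  · simp [(eFrac_eq_one_iff hQ t).2 h]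
  · have h1 : eFrac Q t ≠ 1 := fun h' => h ((eFrac_eq_one_iff hQ t).1 h')
    rw [geom_sum_eq h1, ← eFrac_nat_mul, (eFrac_eq_one_iff hQ _).2 (dvd_mul_right _ _)]
    simp

lemma natCast_dvd_sub_iff_of_lt {Q a b : ℕ} (ha : a < Q) (hb : b < Q) :
    (Q : ℤ) ∣ (a : ℤ) - b ↔ a = b := by
  rw [← Nat.modEq_iff_dvd]
  exact ⟨fun h => (h.eq_of_lt_of_lt hb ha).symm, fun h => h ▸ Nat.ModEq.refl _⟩

/-- The GDAFT preserves the inner product. -/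
lemma innerMN_gdaft (M N : ℕ) (hM : 0 < M) (hN : 0 < N) (A B C : ℤ)
    (hB : IsCoprime B ((M * N : ℕ) : ℤ)) (x y : ZMod (M * N) → ℂ) :
    innerMN M N (gdaft M N A B C x) (gdaft M N A B C y) = innerMN M N x y := by
  have hQ : 0 < M * N := Nat.mul_pos hM hN
  have hQ' : ((M * N : ℕ) : ℂ) ≠ 0 := by exact_mod_cast hQ.ne'
  have hs : (Real.sqrt (M * N) : ℂ)⁻¹ * (Real.sqrt (M * N) : ℂ)⁻¹ = ((M * N : ℕ) : ℂ)⁻¹ := by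
    rw [← mul_inv, ← Complex.ofReal_mul, Real.mul_self_sqrt (by positivity)]
    push_cast
    rfl
  have hterm : ∀ n ∈ Finset.range (M * N),
      gdaft M N A B C x (n : ZMod (M * N)) *
        (starRingEnd ℂ) (gdaft M N A B C y (n : ZMod (M * N))) =
      ∑ m ∈ Finset.range (M * N), ∑ m' ∈ Finset.range (M * N),
        ((M * N : ℕ) : ℂ)⁻¹ * (eFrac (M * N) (C * ((m : ℤ) ^ 2 - (m' : ℤ) ^ 2)) *
          x m * (starRingEnd ℂ) (y m')) * eFrac (M * N) (n * (B * ((m : ℤ) - m'))) := by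
    intro n hn
    simp only [gdaft, ZMod.val_natCast_of_lt (Finset.mem_range.1 hn), map_mul, map_sum, map_inv₀,
      Complex.conj_ofReal, conj_eFrac]
    rw [mul_mul_mul_comm, hs, Finset.sum_mul_sum, Finset.mul_sum]
    refine Finset.sum_congr rfl fun m _ => ?_
    rw [Finset.mul_sum]
    refine Finset.sum_congr rfl fun m' _ => ?_
    have he : eFrac (M * N) (A * (n : ℤ) ^ 2 + B * n * m + C * (m : ℤ) ^ 2) *
        eFrac (M * N) (-(A * (n : ℤ) ^ 2 + B * n * m' + C * (m' : ℤ) ^ 2)) =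
        eFrac (M * N) (C * ((m : ℤ) ^ 2 - (m' : ℤ) ^ 2)) *
          eFrac (M * N) (n * (B * ((m : ℤ) - m'))) := by
      rw [← eFrac_add, ← eFrac_add]
      congr 1
      ring
    linear_combination ((M * N : ℕ) : ℂ)⁻¹ * x m * (starRingEnd ℂ) (y m') * he
  rw [innerMN, innerMN, Finset.sum_congr rfl hterm, Finset.sum_comm]
  refine Finset.sum_congr rfl fun m hm => ?_
  rw [Finset.sum_comm, Finset.sum_eq_single_of_mem m hm]
  · rw [← Finset.mul_sum, sum_eFrac hQ]
    simp only [sub_self, mul_zero, dvd_zero, if_true, eFrac_zero, one_mul]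
    field_simp
  · intro m' hm' hne
    rw [← Finset.mul_sum, sum_eFrac hQ, if_neg, mul_zero]
    rw [show ((M * N : ℕ) : ℤ) ∣ B * ((m : ℤ) - m') ↔ _ from
        ⟨hB.symm.dvd_of_dvd_mul_left, fun h => h.mul_left B⟩,
      natCast_dvd_sub_iff_of_lt (Finset.mem_range.1 hm) (Finset.mem_range.1 hm')]
    exact hne.symm

lemma sum_range_mul_eq_sum_sum {β : Type*} [AddCommMonoid β] (M N : ℕ) (f : ℕ → β) :
    ∑ n ∈ Finset.range (M * N), f n =
      ∑ d ∈ Finset.range N, ∑ k ∈ Finset.range M, f (M * d + k) := by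
  induction N with
  | zero => simp
  | succ N ih => rw [Nat.mul_succ, Finset.sum_range_add, ih, Finset.sum_range_succ]

lemma pulsone_natCast {M N k d : ℕ} (hk : k < M) (hd : d < N) (k0 l0 : ℕ) :
    pulsone M N k0 l0 ((M * d + k : ℕ) : ZMod (M * N)) =
      if k = k0 then (Real.sqrt N : ℂ)⁻¹ * eFrac N (d * l0) else 0 := by
  have hlt : M * d + k < M * N := by nlinarith
  have hdiv : (M * d + k) / M = d := by
    rw [Nat.mul_add_div (by omega), Nat.div_eq_of_lt hk, add_zero]
  rw [pulsone, ZMod.val_natCast_of_lt hlt, Nat.mul_add_mod, Nat.mod_eq_of_lt hk, hdiv]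

lemma innerMN_pulsone {M N k0 k1 l0 l1 : ℕ} (hN : 0 < N)
    (hk0 : k0 < M) (hl0 : l0 < N) (hl1 : l1 < N) :
    innerMN M N (pulsone M N k0 l0) (pulsone M N k1 l1) =
      if (k0, l0) = (k1, l1) then 1 else 0 := by
  have hN' : (N : ℂ) ≠ 0 := by exact_mod_cast hN.ne'
  have hs : (Real.sqrt N : ℂ)⁻¹ * (Real.sqrt N : ℂ)⁻¹ = (N : ℂ)⁻¹ := by
    rw [← mul_inv, ← Complex.ofReal_mul, Real.mul_self_sqrt (by positivity)]
    rfl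
  have hterm : ∀ d ∈ Finset.range N, ∑ k ∈ Finset.range M,
      pulsone M N k0 l0 ((M * d + k : ℕ) : ZMod (M * N)) *
        (starRingEnd ℂ) (pulsone M N k1 l1 ((M * d + k : ℕ) : ZMod (M * N))) =
      (if k0 = k1 then (N : ℂ)⁻¹ else 0) * eFrac N (d * ((l0 : ℤ) - l1)) := by
    intro d hd
    rw [Finset.mem_range] at hd
    rw [Finset.sum_eq_single_of_mem k0 (Finset.mem_range.2 hk0)]
    · rw [pulsone_natCast hk0 hd, pulsone_natCast hk0 hd, if_pos rfl]
      split_ifs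
      · rw [map_mul, map_inv₀, Complex.conj_ofReal, conj_eFrac, mul_mul_mul_comm, hs, ← eFrac_add]
        congr 2
        ring
      · simp
    · intro k hk hne
      rw [pulsone_natCast (Finset.mem_range.1 hk) hd, if_neg hne, zero_mul]
  rw [innerMN, sum_range_mul_eq_sum_sum, Finset.sum_congr rfl hterm, ← Finset.mul_sum,
    sum_eFrac hN]
  simp only [natCast_dvd_sub_iff_of_lt hl0 hl1]
  by_cases hk : k0 = k1 <;> by_cases hl : l0 = l1 <;> simp [hk, hl, hN']

lemma innerMN_sum_smul {ι : Type*} (s : Finset ι) (M N : ℕ) (g : ι → ℂ)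
    (v : ι → ZMod (M * N) → ℂ) (y : ZMod (M * N) → ℂ) :
    innerMN M N (∑ i ∈ s, g i • v i) y = ∑ i ∈ s, g i * innerMN M N (v i) y := by
  simp only [innerMN, Finset.sum_apply, Pi.smul_apply, smul_eq_mul, Finset.sum_mul,
    Finset.mul_sum, mul_assoc]
  exact Finset.sum_comm

/-- An orthonormal family for `innerMN` is linearly independent. -/
lemma linearIndependent_of_innerMN {ι : Type*} [Fintype ι] [DecidableEq ι] (M N : ℕ)
    (v : ι → ZMod (M * N) → ℂ)
    (hv : ∀ i j, innerMN M N (v i) (v j) = if i = j then 1 else 0) :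
    LinearIndependent ℂ v := by
  rw [Fintype.linearIndependent_iff]
  intro g hg j
  have h := innerMN_sum_smul Finset.univ M N g v (v j)
  have h0 : innerMN M N 0 (v j) = 0 := by simp [innerMN]
  rw [hg, h0] at h
  simpa [hv] using h.symm

/-- **Spread carriers form an orthonormal basis.** If `A`, `B`, `C` are each coprime to
`M*N`, the `MN` GDAFTs of the pulsones are orthonormal with respect to
`⟨x,y⟩ = Σ x[n] conj(y[n])`, and consequently they form a basis: they span the
`MN`-dimensional space of functions `ℤ/(MN)ℤ → ℂ`. -/
theorem gdaft_pulsone_orthonormal_basis (M N : ℕ) (hM : 0 < M) (hN : 0 < N) (A B C : ℤ)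
    (hA : IsCoprime A ((M * N : ℕ) : ℤ)) (hB : IsCoprime B ((M * N : ℕ) : ℤ))
    (hC : IsCoprime C ((M * N : ℕ) : ℤ)) :
    (∀ k0 k1 l0 l1 : ℕ, k0 < M → k1 < M → l0 < N → l1 < N →
      innerMN M N (gdaft M N A B C (pulsone M N k0 l0))
          (gdaft M N A B C (pulsone M N k1 l1)) =
        if (k0, l0) = (k1, l1) then 1 else 0) ∧
    Submodule.span ℂ
      (Set.range fun p : Fin M × Fin N =>
        gdaft M N A B C (pulsone M N (p.1 : ℕ) (p.2 : ℕ))) = ⊤ := by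
  have horth : ∀ k0 k1 l0 l1 : ℕ, k0 < M → k1 < M → l0 < N → l1 < N →
      innerMN M N (gdaft M N A B C (pulsone M N k0 l0))
          (gdaft M N A B C (pulsone M N k1 l1)) =
        if (k0, l0) = (k1, l1) then 1 else 0 := by
    intro k0 k1 l0 l1 hk0 _ hl0 hl1
    rw [innerMN_gdaft M N hM hN A B C hB, innerMN_pulsone hN hk0 hl0 hl1]
  refine ⟨horth, ?_⟩
  have : NeZero (M * N) := ⟨(Nat.mul_pos hM hN).ne'⟩
  have : Nonempty (Fin M × Fin N) := ⟨(⟨0, hM⟩, ⟨0, hN⟩)⟩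
  refine LinearIndependent.span_eq_top_of_card_eq_finrank
    (linearIndependent_of_innerMN M N _ fun p q => ?_) (by simp [ZMod.card])
  rw [horth _ _ _ _ p.1.2 q.1.2 p.2.2 q.2.2]
  simp [Prod.ext_iff, Fin.ext_iff]
end
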